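/- arXiv:2001.00475 — 2 statements merged into one kernel-verified Lean document; each statement's English description precedes it below -/
import Mathlib

section
/- Let p > 2 be a prime number and suppose positive integers a, b, Δ with 1 ≤ b < p satisfy ab(ab−1) − pa = Δ². Then the Legendre symbols satisfy (ab/p) = ((ab−1)/p), and this common value is ±1 (in particular it is nonzero). -/
/-- The integer core: `p` does not divide `Δ`. -/
lemma core_not_dvd (p : ℕ) [hF : Fact p.Prime] (hp2 : 2 < p) (a b Δ : ℤ)
    (ha : 0 < a) (hb : 1 ≤ b) (hbp : b < (p : ℤ)) (hΔ : 0 < Δ)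
    (heq : a * b * (a * b - 1) - (p : ℤ) * a = Δ ^ 2) : ¬ (p : ℤ) ∣ Δ := by
  intro hd
  have hpP : Prime (p : ℤ) := Nat.prime_iff_prime_int.mp hF.out
  have hp3 : (3 : ℤ) ≤ p := by exact_mod_cast hp2
  have hdX : (p : ℤ) ∣ a * b * (a * b - 1) := by
    have h1 : a * b * (a * b - 1) = Δ ^ 2 + p * a := by linarith
    rw [h1]
    exact dvd_add (dvd_pow hd two_ne_zero) (dvd_mul_right _ _)
  have hX : 0 < b * (a * b) - b - p := by
    have h1 : 0 < a * (b * (a * b) - b - p) := by nlinarith [pow_pos hΔ 2]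
    exact pos_of_mul_pos_right h1 ha.le
  obtain ⟨D, rfl⟩ := hd
  generalize hq : (p : ℤ) = q at *
  have hD : 1 ≤ D := by
    have : 0 < D := pos_of_mul_pos_right hΔ (by linarith)
    linarith
  have hfac : (2 * b * (a * b - q * D) - (b + q)) * (2 * b * (a * b + q * D) - (b + q))
      = (b + q) ^ 2 := by
    linear_combination 4 * b ^ 2 * heq
  have hN : 0 < (b + q) ^ 2 := by positivity
  have hqD : q ≤ q * D := by nlinarith
  have hbqD : 0 ≤ b * (q * D - q) := mul_nonneg (by linarith) (by linarith)
  have hbq : 0 < b * q := mul_pos (by linarith) (by linarith)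
  have he : 0 < 2 * b * (a * b + q * D) - (b + q) := by nlinarith
  have hd0 : 0 < 2 * b * (a * b - q * D) - (b + q) := by
    rw [← hfac] at hN
    exact pos_of_mul_pos_left hN he.le
  have hU : 0 < a * b - q * D := by
    have : 0 < b * (a * b - q * D) := by nlinarith
    exact pos_of_mul_pos_right this (by linarith)
  rcases hpP.dvd_or_dvd hdX with h | h
  · obtain ⟨k, hk⟩ := h
    rw [hk] at hX hfac he hd0 hU
    have hk1 : D + 1 ≤ k := by
      have : 0 < q * (k - D) := by linarith
      have := pos_of_mul_pos_right this (by linarith)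
      linarith
    have hge : 0 ≤ b * q * (k - D - 1) := mul_nonneg hbq.le (by linarith)
    have h1 : 2 * b * q - b - q ≤ 2 * b * (q * k - q * D) - (b + q) := by nlinarith
    have h2 : 6 * b * q - b - q ≤ 2 * b * (q * k + q * D) - (b + q) := by nlinarith
    have h0 : 0 ≤ (b - 1) * (q - 1) := mul_nonneg (by linarith) (by linarith)
    have h3 : (2 * b * q - b - q) * (6 * b * q - b - q) ≤ (b + q) ^ 2 := by
      rw [← hfac]
      exact mul_le_mul h1 h2 (by nlinarith) hd0.le
    -- 12 b²q² - 8bq(b+q) ≤ 0, i.e. 3bq ≤ 2(b+q)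
    have h4 : b * q * (3 * (b * q) - 2 * (b + q)) ≤ 0 := by nlinarith
    have h5 : 3 * (b * q) - 2 * (b + q) ≤ 0 := by
      by_contra hc
      push Not at hc
      have := mul_pos hbq hc
      linarith
    nlinarith
  · obtain ⟨k, hk⟩ := h
    have hX' : a * b = 1 + q * k := by linarith
    rw [hX'] at hX hfac he hd0 hU
    have hk0 : D ≤ k := by
      by_contra hc
      have : q * (k - D) ≤ q * (-1) := mul_le_mul_of_nonneg_left (by omega) (by linarith)
      linarith
    have hk1 : D + 1 ≤ k := by
      by_contra hc
      have : k = D := by omega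
      subst this
      linarith
    have hge : 0 ≤ b * q * (k - D - 1) := mul_nonneg hbq.le (by linarith)
    have h0 : 0 ≤ (b - 1) * q := mul_nonneg (by linarith) (by linarith)
    have h1 : b + q ≤ 2 * b * (1 + q * k - q * D) - (b + q) := by nlinarith
    have h2 : b + q < 2 * b * (1 + q * k + q * D) - (b + q) := by nlinarith
    nlinarith [mul_le_mul_of_nonneg_right h1 he.le]


/-- Let `p > 2` be a prime and `a, b, Δ` positive integers with `1 ≤ b < p`
satisfying `a*b*(a*b-1) - p*a = Δ^2`. Then the Legendre symbols `(ab/p)` and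
`((ab-1)/p)` are equal, and their common value is `1` or `-1`. -/
theorem stmt_6 (p : ℕ) [Fact p.Prime] (hp2 : 2 < p) (a b Δ : ℤ)
    (ha : 0 < a) (hb : 1 ≤ b) (hbp : b < (p : ℤ)) (hΔ : 0 < Δ)
    (heq : a * b * (a * b - 1) - (p : ℤ) * a = Δ ^ 2) :
    legendreSym p (a * b) = legendreSym p (a * b - 1) ∧
      (legendreSym p (a * b) = 1 ∨ legendreSym p (a * b) = -1) := by
  have hnd := core_not_dvd p hp2 a b Δ ha hb hbp hΔ heq
  have hz : ((Δ : ℤ) : ZMod p) ≠ 0 := by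
    rwa [Ne, ZMod.intCast_zmod_eq_zero_iff_dvd]
  have hm : legendreSym p (a * b) * legendreSym p (a * b - 1) = 1 := by
    have h1 : legendreSym p (Δ ^ 2) = 1 := legendreSym.sq_one' p hz
    rw [legendreSym.mod p (Δ ^ 2), ← heq, Int.sub_mul_emod_self_left, ← legendreSym.mod,
      legendreSym.mul] at h1
    exact h1
  rcases Int.mul_eq_one_iff_eq_one_or_neg_one.mp hm with ⟨h1, h2⟩ | ⟨h1, h2⟩
  · exact ⟨by rw [h1, h2], Or.inl h1⟩
  · exact ⟨by rw [h1, h2], Or.inr h1⟩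
end

section
/- Let p > 2 be a prime number and suppose positive integers x, y, z satisfy (4x − p)yz = x(y + z). If p ≡ 3 (mod 4), then the Legendre symbols satisfy (yz/p) = ((y+z)/p) = 1. -/
lemma jac_aux (p D c m : ℕ) (hD : 0 < D) (hp : Odd p) (hm : Odd m) (h : 4 * (D * c) = p + m) :
    jacobiSym D p = jacobiSym D m := by
  have hN : Odd (4 * D - 1) := by
    rw [Nat.odd_iff]; omega
  have hN1 : jacobiSym D (4 * D - 1) = 1 := by
    have h4 : jacobiSym (4 * (D : ℤ)) (4 * D - 1) = 1 := by
      have : (4 * (D : ℤ)) % ((4 * D - 1 : ℕ) : ℤ) = 1 % ((4 * D - 1 : ℕ) : ℤ) := by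
        apply Int.ModEq.symm
        rw [Int.modEq_iff_dvd]
        refine ⟨1, ?_⟩
        push_cast [Nat.cast_sub (show 1 ≤ 4 * D by omega)]
        ring
      rw [jacobiSym.mod_left' this, jacobiSym.one_left]
    rw [jacobiSym.mul_left] at h4
    have : jacobiSym 4 (4 * D - 1) = 1 := by
      have := jacobiSym.sq_one' (a := 2) (b := 4 * D - 1) (by
        have : Nat.Coprime 2 (4 * D - 1) := (Nat.coprime_two_left).2 hN
        simpa [Int.gcd] using this)
      simpa using this
    rw [this] at h4
    simpa using h4
  have key : jacobiSym D p = jacobiSym D (m * (4 * D - 1)) := by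
    rw [jacobiSym.mod_right (D : ℤ) hp, jacobiSym.mod_right (D : ℤ) (hm.mul hN)]
    congr 1
    simp only [Int.natAbs_natCast]
    have : (p : ℤ) ≡ ((m * (4 * D - 1) : ℕ) : ℤ) [ZMOD ((4 * D : ℕ) : ℤ)] := by
      rw [Int.modEq_iff_dvd]
      refine ⟨m - c, ?_⟩
      push_cast [Nat.cast_sub (show 1 ≤ 4 * D by omega)]
      have h' : (4 * (D * c) : ℤ) = p + m := by exact_mod_cast h
      linear_combination h'
    exact (Int.natCast_modEq_iff.1 this)
  have : NeZero m := ⟨by rintro rfl; simp at hm⟩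
  have : NeZero (4 * D - 1) := ⟨by omega⟩
  rw [key, jacobiSym.mul_right, hN1, mul_one]

lemma jac_aux2 (a b m e : ℕ) (hab : Nat.Coprime a b) (hm : m % 4 = 1) (h : m * e = a + b) :
    jacobiSym ((a * b : ℕ) : ℤ) m = 1 := by
  have hc : Nat.Coprime a m := by
    apply Nat.Coprime.coprime_dvd_right (Dvd.intro e h)
    simpa using hab
  have : ((a * b : ℕ) : ℤ) % m = (-1 * (a : ℤ) ^ 2) % m := by
    apply Int.ModEq.symm
    rw [Int.modEq_iff_dvd]
    refine ⟨a * e, ?_⟩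
    have h' : (m * e : ℤ) = a + b := by exact_mod_cast h
    push_cast
    linear_combination -(a : ℤ) * h'
  rw [jacobiSym.mod_left' this, jacobiSym.mul_left, jacobiSym.sq_one' (by simpa using hc),
    jacobiSym.at_neg_one (Nat.odd_iff.2 (by omega)), ZMod.χ₄_nat_one_mod_four hm, mul_one]

/-- Let `p > 2` be a prime with `p ≡ 3 (mod 4)` and suppose positive integers
`x, y, z` satisfy `(4x - p) y z = x (y + z)`. Then `(yz/p) = ((y+z)/p) = 1`. -/
theorem stmt_12 (p : ℕ) [Fact p.Prime] (hp2 : 2 < p) (hp3 : p % 4 = 3)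
    (x y z : ℤ) (hx : 0 < x) (hy : 0 < y) (hz : 0 < z)
    (heq : (4 * x - (p : ℤ)) * y * z = x * (y + z)) :
    legendreSym p (y * z) = 1 ∧ legendreSym p (y + z) = 1 := by
  have hpp : p.Prime := Fact.out
  have hyz : 0 < y * z := mul_pos hy hz
  have hmpos : 0 < 4 * x - (p : ℤ) := by
    have : 0 < (4 * x - (p : ℤ)) * (y * z) := by
      rw [← mul_assoc, heq]; positivity
    exact pos_of_mul_pos_left this hyz.le
  have hx2 : 2 * x ≤ p := by
    have h1 : y + z ≤ 2 * (y * z) := by nlinarith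
    have h2 : (4 * x - (p : ℤ)) * (y * z) ≤ (2 * x) * (y * z) := by nlinarith
    have := le_of_mul_le_mul_right h2 hyz
    linarith
  -- structure
  have hmain : legendreSym p (y * z) = 1 := by
    lift x to ℕ using hx.le
    lift y to ℕ using hy.le
    lift z to ℕ using hz.le
    obtain ⟨m, hm⟩ : ∃ m : ℕ, (4 * x - (p : ℤ)) = m := ⟨_, (Int.toNat_of_nonneg hmpos.le).symm⟩
    have hm4 : 4 * x = p + m := by omega
    rw [hm] at heq
    norm_cast at heq hx hy hz
    clear hyz
    have hx2' : 2 * x ≤ p := by exact_mod_cast hx2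
    obtain ⟨g, a, b, hg, hab, rfl, rfl⟩ := Nat.exists_coprime' (m := y) (n := z) (Nat.gcd_pos_of_pos_left _ hy)
    have ha : 0 < a := Nat.pos_of_mul_pos_right hy
    have hb : 0 < b := Nat.pos_of_mul_pos_right hz
    have heq1 : m * g * (a * b) = x * (a + b) := by
      apply Nat.eq_of_mul_eq_mul_right hg
      linarith
    have hco : Nat.Coprime (a * b) (a + b) := by
      apply Nat.Coprime.mul_left
      · simpa using hab
      · simpa using hab.symm
    obtain ⟨c, rfl⟩ : a * b ∣ x := hco.dvd_of_dvd_mul_right (Dvd.intro_left _ heq1)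
    have hc : 0 < c := Nat.pos_of_mul_pos_left hx
    have hab0 : 0 < a * b := Nat.mul_pos ha hb
    have heq2 : m * g = c * (a + b) := by
      apply Nat.eq_of_mul_eq_mul_right hab0
      linarith
    have hndvd : ∀ k, 0 < k → k < p → ¬ p ∣ k := fun k h1 h2 h3 => absurd (Nat.le_of_dvd h1 h3) (by omega)
    have hcx : c ≤ a * b * c := Nat.le_mul_of_pos_left _ hab0
    have habx : a * b ≤ a * b * c := Nat.le_mul_of_pos_right _ hc
    have hcm : Nat.Coprime c m := by
      have h1 : Nat.Coprime c p := ((Nat.Prime.coprime_iff_not_dvd hpp).2 (hndvd c hc (by omega))).symm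
      have hd : Nat.gcd c m ∣ p := by
        rw [← Nat.dvd_add_left (Nat.gcd_dvd_right c m), ← hm4]
        exact ((Nat.gcd_dvd_left c m).mul_left _).mul_left _
      exact Nat.eq_one_of_dvd_coprimes h1 (Nat.gcd_dvd_left c m) hd
    obtain ⟨e, rfl⟩ : c ∣ g := hcm.dvd_of_dvd_mul_left (Dvd.intro _ heq2.symm)
    have heq3 : m * e = a + b := by
      apply Nat.eq_of_mul_eq_mul_left hc
      linarith
    have he : ¬ p ∣ e := by
      intro h
      have h1 : p ∣ a + b := heq3 ▸ (h.mul_left m)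
      have h2 := Nat.le_of_dvd (by omega) h1
      have : a + b ≤ a * b + 1 := by nlinarith
      omega
    have hJ : jacobiSym ((a * b : ℕ) : ℤ) p = 1 := by
      rw [jac_aux p (a * b) c m hab0 (Nat.odd_iff.2 (by omega)) (Nat.odd_iff.2 (by omega)) hm4,
        jac_aux2 a b m e hab (by omega) heq3]
    have hgp : ((c * e : ℕ) : ZMod p) ≠ 0 := by
      rw [Ne, ZMod.natCast_eq_zero_iff]
      intro h
      rcases hpp.dvd_mul.1 h with h | h
      · exact hndvd c hc (by omega) h
      · exact he h
    have : ((a * (c * e) : ℕ) : ℤ) * ((b * (c * e) : ℕ) : ℤ) = ((a * b : ℕ) : ℤ) * ((c * e : ℕ) : ℤ) ^ 2 := by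
      push_cast; ring
    rw [this, legendreSym.mul, legendreSym.sq_one' p (by exact_mod_cast hgp), mul_one,
      jacobiSym.legendreSym.to_jacobiSym, hJ]
  refine ⟨hmain, ?_⟩
  have hx0 : ((x : ℤ) : ZMod p) ≠ 0 := by
    rw [Ne, ZMod.intCast_zmod_eq_zero_iff_dvd]
    intro h
    have := Int.le_of_dvd hx h
    omega
  have h20 : ((2 : ℤ) : ZMod p) ≠ 0 := by
    rw [Ne, ZMod.intCast_zmod_eq_zero_iff_dvd]
    intro h
    have := Int.le_of_dvd (by norm_num) h
    omega
  have hz1 : ((y + z : ℤ) : ZMod p) = ((y * z * 2 ^ 2 : ℤ) : ZMod p) := by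
    apply mul_left_cancel₀ hx0
    rw [← Int.cast_mul, ← heq]
    push_cast
    simp
    ring
  have : legendreSym p (y + z) = legendreSym p (y * z * 2 ^ 2) := by
    unfold legendreSym
    rw [hz1]
  rw [this, legendreSym.mul, legendreSym.sq_one' p h20, hmain, mul_one]
end
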